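/- Let T : A(𝕋)₊ → A(𝕋)₊ be a surjective map satisfying (T f + T g)(𝕋) = (f + g)(𝕋) for all f, g ∈ A(𝕋)₊, and let ψ : ℤ → ℤ be a function such that for every n ∈ ℤ, T applied to the function z ↦ z^n equals the function z ↦ z^{ψ(n)}. Then either ψ(n) = n for all n ∈ ℤ, or ψ(n) = −n for all n ∈ ℤ. -/

import Mathlib

/-- The `n`-th Fourier coefficient of a function on the unit circle:
`f̂(n) = (1/2π) ∫₀^{2π} f(e^{iθ}) e^{-inθ} dθ`. -/
noncomputable def fourierCoeffCircle (f : Circle → ℂ) (n : ℤ) : ℂ :=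
  (1 / (2 * Real.pi)) * ∫ θ in (0:ℝ)..(2 * Real.pi),
    f (Circle.exp θ) * Complex.exp (-(n : ℂ) * Complex.I * θ)

/-- Membership in the Wiener algebra `A(𝕋)`: continuous functions on the circle
whose Fourier coefficients are absolutely summable. -/
def InWiener (f : Circle → ℂ) : Prop :=
  Continuous f ∧ Summable fun n : ℤ => ‖fourierCoeffCircle f n‖

/-- Membership in the positive cone `A(𝕋)₊`: members of the Wiener algebra all of
whose Fourier coefficients are nonnegative real numbers. -/
def InWienerPlus (f : Circle → ℂ) : Prop :=
  InWiener f ∧ ∀ n : ℤ, ∃ r : ℝ, 0 ≤ r ∧ fourierCoeffCircle f n = (r : ℂ)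

open Real in
/-- On the circle of length `2π`, `fourierCoeffCircle` is Mathlib's `fourierCoeff`. -/
theorem fourierCoeffCircle_eq_fourierCoeff [Fact (0 < 2 * π)] (f : Circle → ℂ) (n : ℤ) :
    fourierCoeffCircle f n =
      fourierCoeff (fun x : AddCircle (2 * π) => f (AddCircle.toCircle x)) n := by
  rw [fourierCoeff_eq_intervalIntegral _ n 0, fourierCoeffCircle, zero_add, Complex.real_smul]
  have h2π : 2 * π ≠ 0 := by positivity
  congr 1
  · push_cast
    rfl
  · refine intervalIntegral.integral_congr fun θ _ => ?_
    simp only [AddCircle.toCircle_apply_mk, fourier_coe_apply, smul_eq_mul]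
    rw [div_self h2π, one_mul, mul_comm]
    congr 2
    have : (π : ℂ) ≠ 0 := by exact_mod_cast Real.pi_ne_zero
    push_cast
    field_simp

open Real in
theorem fourierCoeffCircle_zpow (n k : ℤ) :
    fourierCoeffCircle (fun z : Circle => (z : ℂ) ^ n) k = if k = n then 1 else 0 := by
  have : Fact (0 < 2 * π) := ⟨by positivity⟩
  have h : (fun x : AddCircle (2 * π) => ((AddCircle.toCircle x : Circle) : ℂ) ^ n) =
      fourier n := by
    ext x
    rw [fourier_apply, AddCircle.toCircle_zsmul, Circle.coe_zpow]
  rw [fourierCoeffCircle_eq_fourierCoeff, h, fourierCoeff_fourier, Pi.single_apply]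

theorem inWienerPlus_zpow (n : ℤ) : InWienerPlus fun z : Circle => (z : ℂ) ^ n := by
  refine ⟨⟨?_, ?_⟩, fun k => ⟨if k = n then 1 else 0, by split_ifs <;> simp, ?_⟩⟩
  · exact continuous_subtype_val.zpow₀ n fun z => Or.inl (Circle.coe_ne_zero z)
  · refine summable_of_ne_finset_zero (s := {n}) fun k hk => ?_
    rw [fourierCoeffCircle_zpow, if_neg (by simpa using hk), norm_zero]
  · rw [fourierCoeffCircle_zpow]
    split_ifs <;> simp

open Real in
theorem InWiener.hasSum {f : Circle → ℂ} (hf : InWiener f) (z : Circle) :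
    HasSum (fun n : ℤ => fourierCoeffCircle f n * (z : ℂ) ^ n) (f z) := by
  have : Fact (0 < 2 * π) := ⟨by positivity⟩
  let F : C(AddCircle (2 * π), ℂ) :=
    ⟨fun x => f (AddCircle.toCircle x), hf.1.comp AddCircle.continuous_toCircle⟩
  have hF : fourierCoeff F = fourierCoeffCircle f :=
    funext fun n => (fourierCoeffCircle_eq_fourierCoeff f n).symm
  obtain ⟨θ, rfl⟩ := Circle.exp_surjective z
  have hθ : AddCircle.toCircle (θ : AddCircle (2 * π)) = Circle.exp θ := by
    rw [AddCircle.toCircle_apply_mk, div_self (by positivity), one_mul]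
  have h := has_pointwise_sum_fourier_series_of_summable (f := F)
    (by rw [hF]; exact hf.2.of_norm) (θ : AddCircle (2 * π))
  have hval : F (θ : AddCircle (2 * π)) = f (Circle.exp θ) := congrArg f hθ
  rw [hval, hF] at h
  simpa only [smul_eq_mul, fourier_apply, AddCircle.toCircle_zsmul, hθ, Circle.coe_zpow] using h

/-- A unimodular function in the positive cone of the Wiener algebra is a monomial. -/
theorem InWienerPlus.exists_eq_zpow {f : Circle → ℂ} (hf : InWienerPlus f)
    (hnorm : ∀ z, ‖f z‖ = 1) : ∃ m : ℤ, f = fun z : Circle => (z : ℂ) ^ m := by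
  choose c hc0 hc using hf.2
  have hsum (z : Circle) : HasSum (fun n : ℤ => (c n : ℂ) * (z : ℂ) ^ n) (f z) := by
    simpa only [hc] using hf.1.hasSum z
  have hone : HasSum c (f 1).re := by
    simpa using Complex.hasSum_re (hsum 1)
  have hf1 : (f 1).re = 1 := by
    have him : HasSum (fun _ : ℤ => (0 : ℝ)) (f 1).im := by
      simpa using Complex.hasSum_im (hsum 1)
    have h := Complex.sq_norm (f 1)
    rw [hnorm, Complex.normSq_apply, him.unique hasSum_zero] at h
    nlinarith [hone.nonneg hc0]
  rw [hf1] at hone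
  obtain ⟨m, hm⟩ : ∃ m, c m ≠ 0 := by
    by_contra! h
    rw [funext h] at hone
    exact one_ne_zero (hone.unique hasSum_zero)
  refine ⟨m, funext fun z => ?_⟩
  set u := (starRingEnd ℂ) (f z) with hu
  have huf : u * f z = 1 := by
    rw [hu, mul_comm, Complex.mul_conj, Complex.normSq_eq_norm_sq, hnorm]; simp
  have hnu (n : ℤ) : ‖u * (z : ℂ) ^ n‖ = 1 := by
    rw [norm_mul, hu, RCLike.norm_conj, hnorm, norm_zpow, Circle.norm_coe]; simp
  have hre : HasSum (fun n => c n * (u * (z : ℂ) ^ n).re) 1 := by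
    have h := Complex.hasSum_re ((hsum z).mul_left u)
    rw [huf, Complex.one_re] at h
    simpa only [mul_left_comm u, Complex.re_ofReal_mul] using h
  have hdiff : HasSum (fun n => c n * (1 - (u * (z : ℂ) ^ n).re)) 0 := by
    simpa [mul_sub] using hone.sub hre
  have hzero := (hasSum_zero_iff_of_nonneg fun n =>
    mul_nonneg (hc0 n) (sub_nonneg.2 ((Complex.re_le_norm _).trans (hnu n).le))).1 hdiff
  have hrem : (u * (z : ℂ) ^ m).re = 1 := by
    have h := (mul_eq_zero.1 (congrFun hzero m)).resolve_left hm
    linarith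
  have huz : u * (z : ℂ) ^ m = 1 := by
    have h := Complex.sq_norm (u * (z : ℂ) ^ m)
    rw [hnu, Complex.normSq_apply, hrem] at h
    exact Complex.ext hrem (by simp only [Complex.one_im]; nlinarith)
  exact mul_left_cancel₀ (left_ne_zero_of_mul_eq_one huf) (huf.trans huz.symm)

theorem Circle.exp_one_zpow_eq_one_iff {k : ℤ} : Circle.exp 1 ^ k = 1 ↔ k = 0 := by
  refine ⟨fun h => ?_, fun h => by rw [h, zpow_zero]⟩
  rw [← Circle.exp_zsmul, Circle.exp_eq_one] at h
  obtain ⟨j, hj⟩ := h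
  by_contra hk
  have hj0 : (j : ℝ) ≠ 0 := by
    intro h0
    rw [h0] at hj
    simp [hk] at hj
  refine irrational_pi ⟨(k : ℚ) / (j * 2), ?_⟩
  push_cast
  rw [zsmul_eq_mul, mul_one] at hj
  rw [hj]
  field_simp

/-- Two unimodular numbers are determined up to order by their sum, if it is nonzero. -/
theorem Circle.eq_or_eq_of_add_eq_add {a b c d : Circle} (h : (a : ℂ) + b = c + d)
    (h0 : (a : ℂ) + b ≠ 0) : a = c ∧ b = d ∨ a = d ∧ b = c := by
  have hconj : (a : ℂ)⁻¹ + (b : ℂ)⁻¹ = (c : ℂ)⁻¹ + (d : ℂ)⁻¹ := by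
    simpa only [map_add, ← Circle.coe_inv_eq_conj, Circle.coe_inv] using
      congrArg (starRingEnd ℂ) h
  have ha := a.coe_ne_zero
  have hb := b.coe_ne_zero
  have hc := c.coe_ne_zero
  have hd := d.coe_ne_zero
  field_simp at hconj
  have hmul : (a : ℂ) * b = c * d := by
    apply mul_left_cancel₀ h0
    linear_combination (-1 : ℂ) * hconj + (a : ℂ) * b * h
  have hprod : ((a : ℂ) - c) * (a - d) = 0 := by
    linear_combination (a : ℂ) * h - hmul
  rcases mul_eq_zero.1 hprod with hac | had
  · exact Or.inl ⟨Circle.ext (sub_eq_zero.1 hac), Circle.ext (by linear_combination h - hac)⟩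
  · exact Or.inr ⟨Circle.ext (sub_eq_zero.1 had), Circle.ext (by linear_combination h - had)⟩

/-- The range of `z ^ m + z ^ n` determines the pair `m, n` up to order and a common factor. -/
theorem mul_eq_mul_of_range_zpow_add_zpow_eq {p q m n : ℤ}
    (h : (Set.range fun z : Circle => (z : ℂ) ^ p + (z : ℂ) ^ q) =
      Set.range fun z : Circle => (z : ℂ) ^ m + (z : ℂ) ^ n) :
    p * n = q * m ∨ p * m = q * n := by
  set z := Circle.exp 1
  obtain ⟨w, hw⟩ := h.subset (Set.mem_range_self z)
  simp only [← Circle.coe_zpow] at hw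
  have hz {k l : ℤ} (hkl : z ^ k = z ^ l) : k = l := by
    rw [← sub_eq_zero, ← Circle.exp_one_zpow_eq_one_iff, zpow_sub, hkl, mul_inv_cancel]
  have h0 : ((z ^ p : Circle) : ℂ) + (z ^ q : Circle) ≠ 0 := by
    intro h0
    have hsq : z ^ (p * 2) = z ^ (q * 2) := by
      rw [zpow_mul, zpow_mul]
      refine Circle.ext ?_
      rw [Circle.coe_zpow _ 2, Circle.coe_zpow _ 2, eq_neg_of_add_eq_zero_left h0]
      exact even_two.neg_zpow _
    have hpq : p = q := by have := hz hsq; lia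
    rw [hpq] at h0
    exact (z ^ q).coe_ne_zero (self_eq_neg.1 (eq_neg_of_add_eq_zero_left h0))
  rcases Circle.eq_or_eq_of_add_eq_add hw.symm h0 with ⟨h1, h2⟩ | ⟨h1, h2⟩
  · left
    apply hz
    rw [zpow_mul, zpow_mul, h1, h2, ← zpow_mul, ← zpow_mul, mul_comm]
  · right
    apply hz
    rw [zpow_mul, zpow_mul, h1, h2, ← zpow_mul, ← zpow_mul, mul_comm]

/-- A function `ℤ → ℤ` fixing `0` and preserving ratios up to inversion is linear. -/
theorem eq_apply_one_mul_of_ratio {ψ : ℤ → ℤ} (h0 : ψ 0 = 0)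
    (h : ∀ m n, ψ m * n = ψ n * m ∨ ψ m * m = ψ n * n) (m : ℤ) : ψ m = ψ 1 * m := by
  obtain ⟨N, hN, hN1⟩ : ∃ N : ℤ, 2 ≤ N ∧ ψ N = ψ 1 * N := by
    refine ⟨|ψ 1| + 2, by linarith [abs_nonneg (ψ 1)], ?_⟩
    set N := |ψ 1| + 2
    rcases h 1 N with hN | hN
    · linarith
    · have hdvd : N ∣ ψ 1 := ⟨ψ N, by linarith⟩
      have ha : ψ 1 = 0 := Int.eq_zero_of_abs_lt_dvd hdvd (by simp [N])
      have hNpos : N ≠ 0 := by have := abs_nonneg (ψ 1); simp only [N]; lia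
      rw [ha, mul_one, eq_comm, mul_eq_zero] at hN
      rw [ha, hN.resolve_right hNpos, zero_mul]
  by_cases hm0 : m = 0
  · rw [hm0, h0, mul_zero]
  rcases h 1 m with hm | hm
  · linarith
  rcases h m N with hmN | hmN
  · rw [hN1] at hmN
    exact mul_right_cancel₀ (b := N) (by lia) (by linarith)
  · have ha : ψ 1 * (N * N - 1) = 0 := by rw [hN1] at hmN; linarith
    have ha0 : ψ 1 = 0 := (mul_eq_zero.1 ha).resolve_right (by nlinarith)
    rw [ha0, mul_one, eq_comm, mul_eq_zero] at hm
    rw [ha0, hm.resolve_right hm0, zero_mul]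

theorem psi_id_or_neg (T : (Circle → ℂ) → (Circle → ℂ))
    (hmap : ∀ f, InWienerPlus f → InWienerPlus (T f))
    (hsurj : ∀ g, InWienerPlus g → ∃ f, InWienerPlus f ∧ T f = g)
    (hspec : ∀ f g, InWienerPlus f → InWienerPlus g →
      (Set.range fun z => T f z + T g z) = (Set.range fun z => f z + g z))
    (ψ : ℤ → ℤ)
    (hψ : ∀ n : ℤ, T (fun z : Circle => (z : ℂ) ^ n) = fun z : Circle => (z : ℂ) ^ (ψ n)) :
    (∀ n : ℤ, ψ n = n) ∨ (∀ n : ℤ, ψ n = -n) := by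
  have hψrange (m n : ℤ) := hspec _ _ (inWienerPlus_zpow m) (inWienerPlus_zpow n)
  simp only [hψ] at hψrange
  have hψ0 : ψ 0 = 0 := by
    obtain ⟨w, hw⟩ := (hψrange 0 0).subset (Set.mem_range_self (Circle.exp 1))
    rw [← Circle.exp_one_zpow_eq_one_iff]
    refine Circle.ext ?_
    rw [Circle.coe_zpow, Circle.coe_one]
    simp only [zpow_zero] at hw
    linear_combination -hw / 2
  have hlin := eq_apply_one_mul_of_ratio hψ0 fun m n =>
    mul_eq_mul_of_range_zpow_add_zpow_eq (hψrange m n)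
  obtain ⟨f, hf, hTf⟩ := hsurj _ (inWienerPlus_zpow 1)
  have hnorm (z : Circle) : ‖f z‖ = 1 := by
    obtain ⟨w, hw⟩ := (hspec f f hf hf).superset (Set.mem_range_self z)
    simp only [hTf, zpow_one] at hw
    have hwz : f z = w := by linear_combination -hw / 2
    rw [hwz, Circle.norm_coe]
  obtain ⟨m, rfl⟩ := hf.exists_eq_zpow hnorm
  have hψm : ψ m = 1 := by
    rw [hψ] at hTf
    rw [← sub_eq_zero, ← Circle.exp_one_zpow_eq_one_iff, zpow_sub, mul_inv_eq_one]
    exact Circle.ext (by simpa using congrFun hTf (Circle.exp 1))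
  rw [hlin] at hψm
  rcases Int.eq_one_or_neg_one_of_mul_eq_one hψm with h | h
  · exact Or.inl fun n => by rw [hlin, h, one_mul]
  · exact Or.inr fun n => by rw [hlin, h, neg_one_mul]
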